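/- arXiv:0909.3385 — 2 statements merged into one kernel-verified Lean document; each statement's English description precedes it below -/
import Mathlib

section
/- The probability measure π(dk) = φ(k)dk on 𝕋 is stationary for the transition kernel with density p, i.e. φ is a probability density on 𝕋 (∫_𝕋 φ(k)dk = 1), for almost every k one has ∫_𝕋 p(k,k')dk' = 1, and for every k' ∈ 𝕋: ∫_𝕋 φ(k)p(k,k')dk = φ(k'). -/
noncomputable section

open MeasureTheory ProbabilityTheory Real Filter Set Topology

/-- The one-dimensional torus `𝕋 = ℝ/ℤ`, identified with `[-1/2, 1/2)`. -/
def Tor : Set ℝ := Set.Ico (-(1/2) : ℝ) (1/2)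

/-- The velocity `v(k) = sin(2πk)/|sin(πk)|` (equal to `0` at `k = 0`). -/
def vv (k : ℝ) : ℝ := Real.sin (2 * π * k) / |Real.sin (π * k)|

/-- The scattering kernel `R(k,k')`. -/
def RR (k k' : ℝ) : ℝ :=
  (4 / 3) * (2 * Real.sin (2 * π * k) ^ 2 * Real.sin (π * k') ^ 2
    + 2 * Real.sin (2 * π * k') ^ 2 * Real.sin (π * k) ^ 2
    - Real.sin (2 * π * k) ^ 2 * Real.sin (2 * π * k') ^ 2)

/-- `φ(k) = ∫_𝕋 R(k,k') dk' = (4/3) sin²(πk)(1+2cos²(πk))`. -/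
def phi (k : ℝ) : ℝ := (4 / 3) * Real.sin (π * k) ^ 2 * (1 + 2 * Real.cos (π * k) ^ 2)

/-- The transition probability density `p(k,k') = R(k,k')/φ(k)` (for `k ≠ 0`). -/
def pp (k k' : ℝ) : ℝ := RR k k' / phi k

/-- `ψ(k) = v(k)/φ(k)` (equal to `0` at `k = 0`). -/
def psi (k : ℝ) : ℝ := vv k / phi k

/-- The `m`-step transition densities: `p¹ = p`,
`p^{m+1}(k,k') = ∫_𝕋 p^m(k,k₁) p(k₁,k') dk₁` (`p⁰` is set to `0`; it is never used). -/
def pm : ℕ → ℝ → ℝ → ℝ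
  | 0, _, _ => 0
  | 1, k, k' => pp k k'
  | (m + 2), k, k' => ∫ k₁ in Tor, pm (m + 1) k k₁ * pp k₁ k'

theorem phi_eq (k : ℝ) :
    phi k = 4 / 3 * sin (π * k) ^ 2 + 2 / 3 * sin (2 * π * k) ^ 2 := by
  rw [phi, show 2 * π * k = 2 * (π * k) by ring, sin_two_mul]
  ring

theorem RR_comm (k k' : ℝ) : RR k k' = RR k' k := by
  unfold RR
  ring

theorem phi_ne_zero {k : ℝ} (h : sin (π * k) ≠ 0) : phi k ≠ 0 := by
  unfold phi
  positivity

theorem phi_mul_pp (k k' : ℝ) : phi k * pp k k' = RR k k' := by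
  by_cases h : sin (π * k) = 0
  · have h2 : sin (2 * π * k) = 0 := by
      rw [show 2 * π * k = 2 * (π * k) by ring, sin_two_mul, h]
      ring
    simp [phi, RR, h, h2]
  · exact mul_div_cancel₀ _ (phi_ne_zero h)

theorem integral_Tor_sin_sq (a b : ℝ) :
    ∫ k in Tor, (a * sin (π * k) ^ 2 + b * sin (2 * π * k) ^ 2) = (a + b) / 2 := by
  have hderiv (c : ℝ) (hc : c ≠ 0) (x : ℝ) :
      HasDerivAt (fun k => k / 2 - sin (2 * (c * k)) / (4 * c)) (sin (c * x) ^ 2) x := by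
    have hlin : HasDerivAt (fun k => 2 * (c * k)) (2 * (c * 1)) x :=
      ((hasDerivAt_id x).const_mul c).const_mul 2
    refine (((hasDerivAt_id x).div_const 2).sub (hlin.sin.div_const (4 * c))).congr_deriv ?_
    rw [cos_two_mul, cos_sq']
    field_simp
    ring
  rw [Tor, integral_Ico_eq_integral_Ioc, ← intervalIntegral.integral_of_le (by norm_num),
    intervalIntegral.integral_eq_sub_of_hasDerivAt
      (fun x _ => ((hderiv π pi_ne_zero x).const_mul a).add
        ((hderiv (2 * π) (by positivity) x).const_mul b))
      (Continuous.intervalIntegrable (by fun_prop) _ _)]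
  have h₁ : 2 * (π * (1 / 2)) = π := by ring
  have h₂ : 2 * (π * -(1 / 2)) = -π := by ring
  have h₃ : 2 * (2 * π * (1 / 2)) = 2 * π := by ring
  have h₄ : 2 * (2 * π * -(1 / 2)) = -(2 * π) := by ring
  simp only [Pi.add_apply, h₁, h₂, h₃, h₄, sin_neg, sin_pi, sin_two_pi]
  ring

theorem integral_Tor_RR (k : ℝ) : ∫ k' in Tor, RR k k' = phi k := by
  have h (k' : ℝ) : RR k k' = 8 / 3 * sin (2 * π * k) ^ 2 * sin (π * k') ^ 2
      + 4 / 3 * (2 * sin (π * k) ^ 2 - sin (2 * π * k) ^ 2) * sin (2 * π * k') ^ 2 := by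
    unfold RR
    ring
  simp only [h, integral_Tor_sin_sq, phi_eq]
  ring

theorem sin_pi_mul_ne_zero_of_mem_Tor {k : ℝ} (hk : k ∈ Tor) (h0 : k ≠ 0) :
    sin (π * k) ≠ 0 := by
  obtain ⟨hl, hr⟩ := hk
  have := pi_pos
  rw [Ne, sin_eq_zero_iff_of_lt_of_lt (by nlinarith) (by nlinarith)]
  positivity

/-- The measure `π(dk) = φ(k)dk` is a stationary probability measure for the
transition kernel with density `p`: `φ` is a probability density on `𝕋`, for almost every `k`
the function `p(k,·)` is a probability density, and `∫ φ(k) p(k,k') dk = φ(k')` for all `k'`. -/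
theorem stationary_measure :
    (∫ k in Tor, phi k) = 1 ∧
    (∀ᵐ k ∂(volume.restrict Tor), (∫ k' in Tor, pp k k') = 1) ∧
    (∀ k' ∈ Tor, (∫ k in Tor, phi k * pp k k') = phi k') := by
  refine ⟨?_, ?_, fun k' _ => ?_⟩
  · simp only [phi_eq, integral_Tor_sin_sq]
    norm_num
  · have hT : MeasurableSet Tor := measurableSet_Ico
    filter_upwards [ae_restrict_mem hT, Measure.ae_ne (volume.restrict Tor) 0] with k hk h0
    simp only [pp, integral_div, integral_Tor_RR]
    exact div_self (phi_ne_zero (sin_pi_mul_ne_zero_of_mem_Tor hk h0))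
  · simp only [phi_mul_pp, RR_comm _ k', integral_Tor_RR]
end
end

section
/- The random variable e·|ψ(K)|, where e is exponential of parameter 1 and K is independent with density φ on 𝕋, has a tail of index 3/2: there exist constants 0 < C₁ ≤ C₂ < ∞ and λ₀ > 0 such that for all λ ≥ λ₀, C₁·λ^{−3/2} ≤ ∫_𝕋 φ(k)·exp(−λ/|ψ(k)|) dk ≤ C₂·λ^{−3/2}. -/
noncomputable section

open MeasureTheory ProbabilityTheory Real Filter Set Topology

lemma phi_nonneg (k : ℝ) : 0 ≤ phi k := by unfold phi; positivity

lemma abs_psi (k : ℝ) : |psi k| = 2 * |Real.cos (π * k)| / phi k := by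
  by_cases hs : Real.sin (π * k) = 0
  · simp [psi, phi, hs]
  · have hs' : |Real.sin (π * k)| ≠ 0 := abs_ne_zero.mpr hs
    rw [psi, abs_div, abs_of_nonneg (phi_nonneg k), vv, mul_assoc, Real.sin_two_mul, abs_div,
      abs_mul, abs_mul, abs_abs, abs_two]
    congr 1
    field_simp

lemma two_mul_abs_le_abs_sin {k : ℝ} (hk : |k| ≤ 1 / 2) : 2 * |k| ≤ |Real.sin (π * k)| := by
  have h := Real.mul_abs_le_abs_sin (x := π * k) (by
    rw [abs_mul, abs_of_pos pi_pos]; nlinarith [pi_pos])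
  rw [abs_mul, abs_of_pos pi_pos] at h
  have : 2 / π * (π * |k|) = 2 * |k| := by field_simp
  linarith

lemma phi_le_sq (k : ℝ) : phi k ≤ 4 * π ^ 2 * k ^ 2 := by
  have h1 : Real.sin (π * k) ^ 2 ≤ (π * k) ^ 2 := sq_le_sq.mpr Real.abs_sin_le_abs
  have h2 : Real.cos (π * k) ^ 2 ≤ 1 := Real.cos_sq_le_one _
  unfold phi
  nlinarith [sq_nonneg (Real.sin (π * k)), sq_nonneg (Real.cos (π * k))]

lemma sq_le_phi {k : ℝ} (hk : |k| ≤ 1 / 2) : 4 * k ^ 2 ≤ phi k := by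
  have h1 : (2 * k) ^ 2 ≤ Real.sin (π * k) ^ 2 := by
    apply sq_le_sq.mpr
    rw [abs_mul, abs_two]
    exact two_mul_abs_le_abs_sin hk
  unfold phi
  nlinarith [mul_nonneg (sq_nonneg (Real.sin (π * k))) (sq_nonneg (Real.cos (π * k))),
    sq_nonneg k]

/-- The probability density of `K` weighted by the tail probability `P[e·|ψ(k)| > λ]`. -/
def tailIntegrand (lam k : ℝ) : ℝ :=
  if psi k = 0 then 0 else phi k * Real.exp (-(lam / |psi k|))

lemma tailIntegrand_nonneg (lam k : ℝ) : 0 ≤ tailIntegrand lam k := by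
  unfold tailIntegrand
  split_ifs
  · exact le_rfl
  · exact mul_nonneg (phi_nonneg k) (Real.exp_nonneg _)

lemma measurable_tailIntegrand (lam : ℝ) : Measurable (tailIntegrand lam) := by
  have hphi : Measurable phi := by unfold phi; fun_prop
  have hpsi : Measurable psi := by
    unfold psi vv
    exact ((by fun_prop : Measurable fun k : ℝ => Real.sin (2 * π * k)).div
      (by fun_prop : Measurable fun k : ℝ => Real.sin (π * k)).abs).div hphi
  have habs : Measurable fun k => |psi k| := hpsi.abs
  unfold tailIntegrand
  exact Measurable.ite (hpsi (measurableSet_singleton 0)) measurable_const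
    (hphi.mul (measurable_const.div habs).neg.exp)

lemma tailIntegrand_le {lam k : ℝ} (hlam : 0 ≤ lam) (hk : |k| ≤ 1 / 2) :
    tailIntegrand lam k ≤ 4 * π ^ 2 * (k ^ 2 * Real.exp (-(lam * k ^ 2))) := by
  unfold tailIntegrand
  split_ifs with h
  · positivity
  · rw [← mul_assoc]
    gcongr
    · exact phi_le_sq k
    · have h0 : 0 < |psi k| := abs_pos.mpr h
      have hphi := sq_le_phi hk
      have hle : k ^ 2 * |psi k| ≤ 1 := by
        rw [abs_psi, ← mul_div_assoc]
        apply div_le_one_of_le₀ _ (phi_nonneg k)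
        nlinarith [Real.abs_cos_le_one (π * k), sq_nonneg k]
      rw [le_div_iff₀ h0]
      nlinarith

lemma le_tailIntegrand {lam k : ℝ} (hlam : 0 ≤ lam) (hk0 : 0 < k) (hk : k ≤ 1 / 4) :
    4 * k ^ 2 * Real.exp (-(4 * π ^ 2 * (lam * k ^ 2))) ≤ tailIntegrand lam k := by
  have habs : |k| ≤ 1 / 2 := by rw [abs_of_pos hk0]; linarith
  have hc : 1 / 2 ≤ |Real.cos (π * k)| := by
    refine le_trans ?_ (le_abs_self _)
    rw [← Real.cos_pi_div_three]
    apply Real.cos_le_cos_of_nonneg_of_le_pi (by positivity) <;> nlinarith [pi_pos]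
  have hphi := sq_le_phi habs
  have hphi0 : 0 < phi k := by nlinarith [pow_pos hk0 2]
  have hpos : 0 < |psi k| := by rw [abs_psi]; positivity
  rw [tailIntegrand, if_neg (abs_pos.mp hpos)]
  gcongr
  rw [div_le_iff₀ hpos]
  have h1 : 1 ≤ 4 * π ^ 2 * k ^ 2 * |psi k| := by
    rw [abs_psi, ← mul_div_assoc, one_le_div hphi0]
    nlinarith [phi_le_sq k, mul_nonneg (sq_nonneg π) (sq_nonneg k)]
  nlinarith

lemma integrableOn_tailIntegrand {lam : ℝ} (hlam : 0 ≤ lam) :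
    IntegrableOn (tailIntegrand lam) Tor := by
  refine Measure.integrableOn_of_bounded (M := π ^ 2) (by simp [Tor])
    (measurable_tailIntegrand lam).aestronglyMeasurable ?_
  refine ae_restrict_of_forall_mem (by unfold Tor; measurability) fun k hk => ?_
  have habs : |k| ≤ 1 / 2 := abs_le.mpr ⟨hk.1, hk.2.le⟩
  rw [Real.norm_of_nonneg (tailIntegrand_nonneg lam k)]
  refine (tailIntegrand_le hlam habs).trans ?_
  have he : Real.exp (-(lam * k ^ 2)) ≤ 1 := Real.exp_le_one_iff.mpr (by
    have := mul_nonneg hlam (sq_nonneg k); linarith)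
  have hsq : k ^ 2 ≤ 1 / 4 := by rw [← sq_abs]; nlinarith [abs_nonneg k]
  calc 4 * π ^ 2 * (k ^ 2 * Real.exp (-(lam * k ^ 2)))
      ≤ 4 * π ^ 2 * (1 / 4 * 1) := by gcongr
    _ = π ^ 2 := by ring

lemma rpow_neg_three_halves {lam : ℝ} (hlam : 0 < lam) :
    lam ^ (-(3 : ℝ) / 2) = lam⁻¹ * (√lam)⁻¹ := by
  rw [Real.sqrt_eq_rpow, ← Real.rpow_neg_one, ← Real.rpow_neg hlam.le, ← Real.rpow_add hlam]
  norm_num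

lemma integrable_sq_mul_exp_neg_mul_sq {lam : ℝ} (hlam : 0 < lam) :
    Integrable fun x : ℝ => x ^ 2 * Real.exp (-(lam * x ^ 2)) := by
  have h := integrable_rpow_mul_exp_neg_mul_sq hlam (s := 2) (by norm_num)
  simpa using h

lemma integral_sq_mul_exp_neg_mul_sq {lam : ℝ} (hlam : 0 < lam) :
    ∫ k : ℝ, k ^ 2 * Real.exp (-(lam * k ^ 2))
      = (∫ x : ℝ, x ^ 2 * Real.exp (-x ^ 2)) * lam ^ (-(3 : ℝ) / 2) := by
  have h := Measure.integral_comp_mul_left (fun x : ℝ => x ^ 2 * Real.exp (-x ^ 2)) (√lam)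
  simp only [mul_pow, Real.sq_sqrt hlam.le, mul_assoc, integral_const_mul, smul_eq_mul] at h
  rw [abs_of_nonneg (by positivity)] at h
  rw [rpow_neg_three_halves hlam, mul_comm, mul_assoc, ← h, inv_mul_cancel_left₀ hlam.ne']

lemma setIntegral_tailIntegrand_le {lam : ℝ} (hlam : 0 < lam) :
    ∫ k in Tor, tailIntegrand lam k
      ≤ 4 * π ^ 2 * (∫ x : ℝ, x ^ 2 * Real.exp (-x ^ 2)) * lam ^ (-(3 : ℝ) / 2) := by
  have hint := (integrable_sq_mul_exp_neg_mul_sq hlam).const_mul (4 * π ^ 2)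
  calc ∫ k in Tor, tailIntegrand lam k
      ≤ ∫ k in Tor, 4 * π ^ 2 * (k ^ 2 * Real.exp (-(lam * k ^ 2))) :=
        setIntegral_mono_on (integrableOn_tailIntegrand hlam.le) hint.integrableOn
          measurableSet_Ico fun k hk =>
            tailIntegrand_le hlam.le (abs_le.mpr ⟨hk.1, hk.2.le⟩)
    _ ≤ ∫ k : ℝ, 4 * π ^ 2 * (k ^ 2 * Real.exp (-(lam * k ^ 2))) :=
        setIntegral_le_integral hint (Eventually.of_forall fun k => by positivity)
    _ = _ := by rw [integral_const_mul, integral_sq_mul_exp_neg_mul_sq hlam, ← mul_assoc]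

lemma le_setIntegral_tailIntegrand {lam : ℝ} (hlam : 16 ≤ lam) :
    Real.exp (-(4 * π ^ 2)) / 2 * lam ^ (-(3 : ℝ) / 2) ≤ ∫ k in Tor, tailIntegrand lam k := by
  have hlam0 : 0 < lam := by linarith
  have hr4 : 4 ≤ √lam := Real.le_sqrt_of_sq_le (by linarith)
  set a : ℝ := (√lam)⁻¹ with ha
  have ha0 : 0 < a := by positivity
  have ha4 : a ≤ 1 / 4 := by
    rw [ha, one_div]; exact inv_anti₀ (by norm_num) hr4
  have hasq : a ^ 2 = lam⁻¹ := by rw [ha, inv_pow, Real.sq_sqrt hlam0.le]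
  have hlama : lam * a ^ 2 = 1 := by rw [hasq, mul_inv_cancel₀ hlam0.ne']
  have hsub : Set.Icc (a / 2) a ⊆ Tor := fun k hk =>
    ⟨by linarith [hk.1], by linarith [hk.2]⟩
  have hint := integrableOn_tailIntegrand hlam0.le
  calc Real.exp (-(4 * π ^ 2)) / 2 * lam ^ (-(3 : ℝ) / 2)
      = ∫ _ in Set.Icc (a / 2) a, lam⁻¹ * Real.exp (-(4 * π ^ 2)) := by
        rw [rpow_neg_three_halves hlam0, setIntegral_const, Measure.real, Real.volume_Icc,
          ENNReal.toReal_ofReal (by linarith), smul_eq_mul, ← ha]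
        ring
    _ ≤ ∫ k in Set.Icc (a / 2) a, tailIntegrand lam k := by
        refine setIntegral_mono_on (integrableOn_const (by simp)) (hint.mono_set hsub)
          measurableSet_Icc fun k hk => ?_
        have hk0 : 0 < k := by linarith [hk.1]
        refine le_trans ?_ (le_tailIntegrand hlam0.le hk0 (hk.2.trans ha4))
        have h1 : lam⁻¹ ≤ 4 * k ^ 2 := by rw [← hasq]; nlinarith [hk.1]
        have h2 : lam * k ^ 2 ≤ 1 := by
          rw [← hlama]; gcongr; exact hk.2
        have h3 : 4 * π ^ 2 * (lam * k ^ 2) ≤ 4 * π ^ 2 :=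
          mul_le_of_le_one_right (by positivity) h2
        exact mul_le_mul h1 (Real.exp_le_exp.mpr (neg_le_neg h3)) (Real.exp_nonneg _)
          (by positivity)
    _ ≤ ∫ k in Tor, tailIntegrand lam k :=
        setIntegral_mono_set hint (Eventually.of_forall fun k => tailIntegrand_nonneg lam k)
          hsub.eventuallyLE

/-- The random variable `e·|ψ(K)|`, with `e` exponential of parameter 1 and `K`
independent with density `φ` on `𝕋`, has a tail of index `3/2`: for all large `λ`,
`C₁ λ^{-3/2} ≤ ∫_𝕋 φ(k) exp(−λ/|ψ(k)|) dk ≤ C₂ λ^{-3/2}` (the integrand vanishes where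
`ψ(k) = 0`). -/
theorem tail_index_three_halves :
    ∃ C₁ C₂ lam₀ : ℝ, 0 < C₁ ∧ C₁ ≤ C₂ ∧ 0 < lam₀ ∧
      ∀ lam : ℝ, lam₀ ≤ lam →
        C₁ * lam ^ (-(3 : ℝ) / 2)
            ≤ (∫ k in Tor, if psi k = 0 then 0 else phi k * Real.exp (-(lam / |psi k|))) ∧
        (∫ k in Tor, if psi k = 0 then 0 else phi k * Real.exp (-(lam / |psi k|)))
            ≤ C₂ * lam ^ (-(3 : ℝ) / 2) := by
  refine ⟨Real.exp (-(4 * π ^ 2)) / 2,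
    max (Real.exp (-(4 * π ^ 2)) / 2) (4 * π ^ 2 * ∫ x : ℝ, x ^ 2 * Real.exp (-x ^ 2)), 16,
    by positivity, le_max_left _ _, by norm_num, fun lam hlam => ?_⟩
  have hlam0 : 0 < lam := by linarith
  exact ⟨le_setIntegral_tailIntegrand hlam, (setIntegral_tailIntegrand_le hlam0).trans
    (mul_le_mul_of_nonneg_right (le_max_right _ _) (by positivity))⟩
end
end
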